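/- arXiv:1605.03880 — 2 statements merged into one kernel-verified Lean document; each statement's English description precedes it below -/
import Mathlib

section
/- Work in the monoid algebra ℤ[B_n], where B_n is the monoid of binary relations on Fin n under composition of relations, with identity the identity relation. For X ⊆ Fin n let Δ_X denote the diagonal relation {(x, x) : x ∈ X} and set ε_X := Σ_{Y ⊆ X} (-1)^(|X| - |Y|) [Δ_Y]. Let σ be a permutation of Fin n and X, Y ⊆ Fin n such that the image of X under σ equals Y. Let ρ_σ be the relation {(σ x, x) : x ∈ X}. Then ε_Y * [graph σ] * ε_X = Σ_{ρ ⊆ ρ_σ} (-1)^(|ρ_σ| - |ρ|) [ρ], where the sum runs over all subrelations ρ of ρ_σ (i.e., all subsets of the finite set of pairs ρ_σ). -/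
/-- Binary relations on `Fin n`, as finite sets of pairs `(z, x)`. -/
abbrev BRel (n : ℕ) := Finset (Fin n × Fin n)

/-- Composition of binary relations: `(z, x) ∈ relComp β α ↔ ∃ y, (z, y) ∈ β ∧ (y, x) ∈ α`. -/
def relComp {n : ℕ} (β α : BRel n) : BRel n :=
  Finset.univ.filter fun p => ∃ y : Fin n, (p.1, y) ∈ β ∧ (y, p.2) ∈ α

/-- The identity relation on `Fin n`. -/
def relId (n : ℕ) : BRel n :=
  Finset.univ.filter fun p => p.1 = p.2

theorem relComp_assoc {n : ℕ} (a b c : BRel n) :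
    relComp (relComp a b) c = relComp a (relComp b c) := by
  ext ⟨z, x⟩
  simp only [relComp, Finset.mem_filter, Finset.mem_univ, true_and]
  constructor
  · rintro ⟨y, ⟨w, hw, hwy⟩, hc⟩
    exact ⟨w, hw, y, hwy, hc⟩
  · rintro ⟨w, hw, y, hwy, hc⟩
    exact ⟨y, ⟨w, hw, hwy⟩, hc⟩

theorem relId_comp {n : ℕ} (a : BRel n) : relComp (relId n) a = a := by
  ext ⟨z, x⟩
  simp only [relComp, relId, Finset.mem_filter, Finset.mem_univ, true_and]
  constructor
  · rintro ⟨y, hy, hmem⟩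
    simpa [hy] using hmem
  · intro h
    exact ⟨z, rfl, h⟩

theorem comp_relId {n : ℕ} (a : BRel n) : relComp a (relId n) = a := by
  ext ⟨z, x⟩
  simp only [relComp, relId, Finset.mem_filter, Finset.mem_univ, true_and]
  constructor
  · rintro ⟨y, hmem, hy⟩
    simpa [hy] using hmem
  · intro h
    exact ⟨x, h, rfl⟩

/-- The monoid `B_n` of binary relations on `Fin n` under composition of relations,
with identity the identity relation. -/
instance brelMonoid (n : ℕ) : Monoid (BRel n) where
  mul := relComp
  one := relId n
  mul_assoc := relComp_assoc
  one_mul := relId_comp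
  mul_one := comp_relId

/-- The graph of a permutation `σ`: the relation consisting of all pairs `(σ x, x)`. -/
def permGraph {n : ℕ} (σ : Equiv.Perm (Fin n)) : BRel n :=
  Finset.univ.image fun x => (σ x, x)

/-- The diagonal relation `Δ_X = {(x, x) : x ∈ X}`. -/
def diagRel {n : ℕ} (X : Finset (Fin n)) : BRel n :=
  X.image fun x => (x, x)

/-- The idempotent `ε_X = ∑_{Y ⊆ X} (-1)^(|X| - |Y|) [Δ_Y]` in `ℤ[B_n]`. -/
noncomputable def eps {n : ℕ} (X : Finset (Fin n)) : MonoidAlgebra ℤ (BRel n) :=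
  ∑ Y ∈ X.powerset, MonoidAlgebra.single (diagRel Y) ((-1 : ℤ) ^ (X.card - Y.card))

/-- The relation `ρ_σ = {(σ x, x) : x ∈ X}`. -/
def rhoRel {n : ℕ} (σ : Equiv.Perm (Fin n)) (X : Finset (Fin n)) : BRel n :=
  X.image fun x => (σ x, x)

theorem single_mul_single_brel {n : ℕ} (a b : BRel n) (r s : ℤ) :
    (MonoidAlgebra.single a r * MonoidAlgebra.single b s : MonoidAlgebra ℤ (BRel n)) =
      MonoidAlgebra.single (relComp a b) (r * s) :=
  MonoidAlgebra.single_mul_single ..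

theorem mem_diagRel {n : ℕ} {X : Finset (Fin n)} {z x : Fin n} :
    (z, x) ∈ diagRel X ↔ z ∈ X ∧ z = x := by
  simp only [diagRel, Finset.mem_image, Prod.mk.injEq]
  grind

theorem mem_rhoRel {n : ℕ} {σ : Equiv.Perm (Fin n)} {X : Finset (Fin n)} {z x : Fin n} :
    (z, x) ∈ rhoRel σ X ↔ x ∈ X ∧ z = σ x := by
  simp only [rhoRel, Finset.mem_image, Prod.mk.injEq]
  grind

theorem mem_permGraph {n : ℕ} {σ : Equiv.Perm (Fin n)} {z x : Fin n} :
    (z, x) ∈ permGraph σ ↔ z = σ x := by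
  simp [permGraph, eq_comm]

theorem mem_relComp {n : ℕ} {β α : BRel n} {z x : Fin n} :
    (z, x) ∈ relComp β α ↔ ∃ y, (z, y) ∈ β ∧ (y, x) ∈ α := by
  simp [relComp]

theorem diagRel_comp_diagRel {n : ℕ} (Y Z : Finset (Fin n)) :
    relComp (diagRel Y) (diagRel Z) = diagRel (Y ∩ Z) := by
  ext ⟨z, x⟩
  simp only [mem_relComp, mem_diagRel, Finset.mem_inter]
  grind

theorem diagRel_image_comp_permGraph {n : ℕ} (σ : Equiv.Perm (Fin n)) (Z : Finset (Fin n)) :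
    relComp (diagRel (Z.image fun x => σ x)) (permGraph σ) = rhoRel σ Z := by
  ext ⟨z, x⟩
  simp only [mem_relComp, mem_diagRel, mem_permGraph, mem_rhoRel, Finset.mem_image]
  constructor
  · rintro ⟨y, ⟨⟨w, hw, rfl⟩, rfl⟩, hy⟩
    exact ⟨σ.injective hy ▸ hw, hy⟩
  · rintro ⟨hx, rfl⟩
    exact ⟨σ x, ⟨⟨x, hx, rfl⟩, rfl⟩, rfl⟩

theorem permGraph_comp_diagRel {n : ℕ} (σ : Equiv.Perm (Fin n)) (Z : Finset (Fin n)) :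
    relComp (permGraph σ) (diagRel Z) = rhoRel σ Z := by
  ext ⟨z, x⟩
  simp only [mem_relComp, mem_diagRel, mem_permGraph, mem_rhoRel]
  grind

/-- `ε_X` absorbs `[Δ_X]`. -/
theorem eps_mul_diagRel_self {n : ℕ} (X : Finset (Fin n)) :
    eps X * MonoidAlgebra.single (diagRel X) 1 = eps X := by
  rw [eps, Finset.sum_mul]
  refine Finset.sum_congr rfl fun Y hY => ?_
  rw [single_mul_single_brel, diagRel_comp_diagRel,
    Finset.inter_eq_left.mpr (Finset.mem_powerset.mp hY), mul_one]

/-- `ε_X` is annihilated by `[Δ_Z]` whenever `Z` does not contain `X`. -/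
theorem eps_mul_diagRel_of_notMem {n : ℕ} {X Z : Finset (Fin n)} {a : Fin n}
    (ha : a ∈ X) (haZ : a ∉ Z) :
    eps X * MonoidAlgebra.single (diagRel Z) 1 = 0 := by
  obtain ⟨W, haW, rfl⟩ : ∃ W, a ∉ W ∧ insert a W = X :=
    ⟨X.erase a, Finset.notMem_erase a X, Finset.insert_erase ha⟩
  rw [eps, Finset.sum_mul, Finset.sum_powerset_insert haW, ← Finset.sum_add_distrib]
  refine Finset.sum_eq_zero fun t ht => ?_
  have htW := Finset.mem_powerset.mp ht
  have hcard : t.card ≤ W.card := Finset.card_le_card htW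
  rw [single_mul_single_brel, single_mul_single_brel, diagRel_comp_diagRel, diagRel_comp_diagRel,
    Finset.insert_inter_of_notMem haZ, ← MonoidAlgebra.single_add,
    Finset.card_insert_of_notMem haW, Finset.card_insert_of_notMem fun hat => haW (htW hat),
    Nat.add_sub_add_right, Nat.sub_add_comm hcard, pow_succ]
  simp

theorem eps_mul_self {n : ℕ} (X : Finset (Fin n)) : eps X * eps X = eps X := by
  have hsmul (Z : Finset (Fin n)) (c : ℤ) :
      eps X * MonoidAlgebra.single (diagRel Z) c =
        c • (eps X * MonoidAlgebra.single (diagRel Z) 1) := by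
    rw [← mul_smul_comm, MonoidAlgebra.smul_single, smul_eq_mul, mul_one]
  conv_lhs => enter [2]; rw [eps]
  rw [Finset.mul_sum, Finset.sum_eq_single_of_mem X (Finset.mem_powerset_self X)]
  · rw [hsmul, eps_mul_diagRel_self, Nat.sub_self, pow_zero, one_smul]
  · intro Z hZ hne
    obtain ⟨a, ha, haZ⟩ := Finset.exists_of_ssubset
      (Finset.ssubset_iff_subset_ne.mpr ⟨Finset.mem_powerset.mp hZ, hne⟩)
    rw [hsmul, eps_mul_diagRel_of_notMem ha haZ, smul_zero]

theorem permGraph_mul_eps {n : ℕ} (σ : Equiv.Perm (Fin n)) (X : Finset (Fin n)) :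
    MonoidAlgebra.single (permGraph σ) 1 * eps X =
      ∑ Z ∈ X.powerset, MonoidAlgebra.single (rhoRel σ Z) ((-1 : ℤ) ^ (X.card - Z.card)) := by
  simp only [eps, Finset.mul_sum, single_mul_single_brel, permGraph_comp_diagRel, one_mul]

theorem eps_image_mul_permGraph {n : ℕ} (σ : Equiv.Perm (Fin n)) (X : Finset (Fin n)) :
    eps (X.image fun x => σ x) * MonoidAlgebra.single (permGraph σ) 1 =
      MonoidAlgebra.single (permGraph σ) 1 * eps X := by
  rw [permGraph_mul_eps, eps, Finset.powerset_image, Finset.sum_image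
    (Finset.image_injective σ.injective).injOn, Finset.sum_mul]
  refine Finset.sum_congr rfl fun Z _ => ?_
  rw [single_mul_single_brel, diagRel_image_comp_permGraph, mul_one,
    Finset.card_image_of_injective _ σ.injective, Finset.card_image_of_injective _ σ.injective]

/-- If `σ` maps `X` onto `Y`, then in `ℤ[B_n]` one has
`ε_Y * [graph σ] * ε_X = ∑_{ρ ⊆ ρ_σ} (-1)^(|ρ_σ| - |ρ|) [ρ]`. -/
theorem eps_graph_eps_of_image_eq {n : ℕ} (σ : Equiv.Perm (Fin n))
    (X Y : Finset (Fin n)) (h : X.image (fun x => σ x) = Y) :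
    eps Y * MonoidAlgebra.single (permGraph σ) 1 * eps X =
      ∑ ρ ∈ (rhoRel σ X).powerset,
        MonoidAlgebra.single ρ ((-1 : ℤ) ^ ((rhoRel σ X).card - ρ.card)) := by
  have hinj : Function.Injective fun x => (σ x, x) := fun _ _ hxy => (Prod.mk.inj hxy).2
  rw [← h, eps_image_mul_permGraph, mul_assoc, eps_mul_self, permGraph_mul_eps]
  simp only [rhoRel]
  rw [Finset.powerset_image, Finset.sum_image (Finset.image_injective hinj).injOn]
  simp only [Finset.card_image_of_injective _ hinj]
end

section
/- Work in the monoid algebra ℤ[B_n], where B_n is the monoid of binary relations on Fin n under composition of relations. Call a relation r on Fin n a partial bijection if r is the graph {(f x, x) : x ∈ D} of an injective function f defined on a subset D of Fin n (D is the domain of r, and {f x : x ∈ D} is the range of r). For a partial bijection r define the Möbius element m_r := Σ_{ρ ⊆ r} (-1)^(|r| - |ρ|) [ρ], summing over all subsets ρ of the finite set of pairs r (each such ρ is again a partial bijection). Then for partial bijections r and s: m_r * m_s = m_{r ∘ s} if the domain of r equals the range of s, and m_r * m_s = 0 otherwise. (This is the multiplication rule for the Möbius basis of ℤ[IS_n]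 realized inside ℤ[B_n], underlying the isomorphism of the decategorification with ℤ[IS_n].) -/
/-- A relation is a partial bijection if it is the graph `{(f x, x) : x ∈ D}` of a
function `f` injective on a subset `D` of `Fin n`. -/
def IsPartialBij {n : ℕ} (r : BRel n) : Prop :=
  ∃ (D : Finset (Fin n)) (f : Fin n → Fin n),
    Set.InjOn f ↑D ∧ r = D.image fun x => (f x, x)

/-- The domain of a relation: the set of second components of its pairs. -/
def dom {n : ℕ} (r : BRel n) : Finset (Fin n) := r.image Prod.snd

/-- The range of a relation: the set of first components of its pairs. -/
def ran {n : ℕ} (r : BRel n) : Finset (Fin n) := r.image Prod.fst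

/-- The Möbius element `m_r = ∑_{ρ ⊆ r} (-1)^(|r| - |ρ|) [ρ]` in `ℤ[B_n]`. -/
noncomputable def mob {n : ℕ} (r : BRel n) : MonoidAlgebra ℤ (BRel n) :=
  ∑ ρ ∈ r.powerset, MonoidAlgebra.single ρ ((-1 : ℤ) ^ (r.card - ρ.card))

theorem IsPartialBij.injOn_fst {n : ℕ} {r : BRel n} (hr : IsPartialBij r) :
    Set.InjOn Prod.fst (r : Set (Fin n × Fin n)) := by
  obtain ⟨D, f, hf, rfl⟩ := hr
  intro p hp q hq h
  obtain ⟨x, hx, rfl⟩ := Finset.mem_image.1 hp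
  obtain ⟨y, hy, rfl⟩ := Finset.mem_image.1 hq
  rw [hf hx hy h]

theorem mem_relComp_s18 {n : ℕ} {r s : BRel n} {p : Fin n × Fin n} :
    p ∈ relComp r s ↔ ∃ y, (p.1, y) ∈ r ∧ (y, p.2) ∈ s := by
  simp [relComp]

theorem mem_dom {n : ℕ} {r : BRel n} {y : Fin n} : y ∈ dom r ↔ ∃ z, (z, y) ∈ r := by
  simp [dom]

theorem mem_ran {n : ℕ} {r : BRel n} {y : Fin n} : y ∈ ran r ↔ ∃ x, (y, x) ∈ r := by
  simp [ran]

theorem relComp_insert_left {n : ℕ} {s : BRel n} {z y : Fin n} (hy : y ∉ ran s) (r : BRel n) :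
    relComp (insert (z, y) r) s = relComp r s := by
  ext p
  simp only [mem_ran, mem_relComp_s18, Finset.mem_insert, Prod.mk.injEq] at hy ⊢
  grind

theorem relComp_insert_right {n : ℕ} {r : BRel n} {y x : Fin n} (hy : y ∉ dom r) (s : BRel n) :
    relComp r (insert (y, x) s) = relComp r s := by
  ext p
  simp only [mem_dom, mem_relComp_s18, Finset.mem_insert, Prod.mk.injEq] at hy ⊢
  grind

/-- An alternating sum over subsets vanishes if its terms ignore some element. -/
theorem sum_powerset_single_eq_zero {α β : Type*} [DecidableEq α] {r : Finset α} {p : α}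
    (hp : p ∈ r) (g : Finset α → β) (hg : ∀ ρ, g (insert p ρ) = g ρ) (c : ℤ) :
    ∑ ρ ∈ r.powerset,
      (MonoidAlgebra.single (g ρ) ((-1 : ℤ) ^ (r.card - ρ.card) * c) : MonoidAlgebra ℤ β) = 0 := by
  have hpe : p ∉ r.erase p := Finset.notMem_erase p r
  rw [← Finset.insert_erase hp, Finset.sum_powerset_insert hpe, ← Finset.sum_add_distrib]
  refine Finset.sum_eq_zero fun ρ hρ => ?_
  have hρ' := Finset.mem_powerset.1 hρ
  have hcard := Finset.card_le_card hρ'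
  rw [hg, Finset.card_insert_of_notMem hpe,
    Finset.card_insert_of_notMem fun h => hpe (hρ' h), Nat.add_sub_add_right,
    Nat.sub_add_comm hcard, pow_succ, ← MonoidAlgebra.single_add]
  simp

theorem mob_mul_single {n : ℕ} (r s : BRel n) (c : ℤ) :
    mob r * MonoidAlgebra.single s c =
      ∑ ρ ∈ r.powerset, MonoidAlgebra.single (relComp ρ s) ((-1 : ℤ) ^ (r.card - ρ.card) * c) := by
  simp only [mob, Finset.sum_mul, MonoidAlgebra.single_mul_single]
  rfl

theorem single_mul_mob {n : ℕ} (r s : BRel n) (c : ℤ) :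
    MonoidAlgebra.single r c * mob s =
      ∑ σ ∈ s.powerset, MonoidAlgebra.single (relComp r σ) ((-1 : ℤ) ^ (s.card - σ.card) * c) := by
  simp only [mob, Finset.mul_sum, MonoidAlgebra.single_mul_single, mul_comm c]
  rfl

theorem mob_mul_single_eq_zero {n : ℕ} {r s : BRel n} (h : ¬dom r ⊆ ran s) (c : ℤ) :
    mob r * MonoidAlgebra.single s c = 0 := by
  obtain ⟨y, hyr, hys⟩ := Finset.not_subset.1 h
  obtain ⟨z, hz⟩ := mem_dom.1 hyr
  rw [mob_mul_single]
  exact sum_powerset_single_eq_zero hz (relComp · s) (relComp_insert_left hys) c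

theorem single_mul_mob_eq_zero {n : ℕ} {r s : BRel n} (h : ¬ran s ⊆ dom r) (c : ℤ) :
    MonoidAlgebra.single r c * mob s = 0 := by
  obtain ⟨y, hys, hyr⟩ := Finset.not_subset.1 h
  obtain ⟨x, hx⟩ := mem_ran.1 hys
  rw [single_mul_mob]
  exact sum_powerset_single_eq_zero hx (relComp r) (relComp_insert_right hyr) c

theorem mob_image {n : ℕ} {r : BRel n} {g : Fin n × Fin n → Fin n × Fin n}
    (hg : Set.InjOn g (r : Set (Fin n × Fin n))) :
    mob (r.image g) =
      ∑ ρ ∈ r.powerset, MonoidAlgebra.single (ρ.image g) ((-1 : ℤ) ^ (r.card - ρ.card)) := by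
  have hinj : Set.InjOn (Finset.image g) (r.powerset : Set (BRel n)) := by
    intro ρ hρ σ hσ h
    have hρ' : (ρ : Set (Fin n × Fin n)) ⊆ r := by simpa using hρ
    have hσ' : (σ : Set (Fin n × Fin n)) ⊆ r := by simpa using hσ
    rw [← Finset.coe_inj, Finset.coe_image, Finset.coe_image,
      hg.image_eq_image_iff hρ' hσ'] at h
    exact Finset.coe_inj.1 h
  rw [mob, Finset.powerset_image, Finset.sum_image hinj]
  refine Finset.sum_congr rfl fun ρ hρ => ?_
  rw [Finset.card_image_of_injOn hg,
    Finset.card_image_of_injOn (hg.mono (Finset.coe_subset.2 (Finset.mem_powerset.1 hρ)))]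

theorem mob_mul_single_one {n : ℕ} {r s : BRel n} (hr : IsPartialBij r) (hs : IsPartialBij s)
    (h : dom r ⊆ ran s) : mob r * MonoidAlgebra.single s 1 = mob (relComp r s) := by
  have hex : ∀ y, ∃ x, y ∈ ran s → (y, x) ∈ s := fun y => by
    by_cases hy : y ∈ ran s
    · exact (mem_ran.1 hy).imp fun _ hx _ => hx
    · exact ⟨y, fun hy' => absurd hy' hy⟩
  choose k hk using hex
  have himage : ∀ ρ ⊆ r, relComp ρ s = ρ.image fun p => (p.1, k p.2) := by
    rintro ρ hρ
    ext ⟨z, x⟩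
    simp only [mem_relComp_s18, Finset.mem_image, Prod.exists, Prod.mk.injEq]
    constructor
    · rintro ⟨y, hy, hyx⟩
      have := hs.injOn_fst (hk y (mem_ran.2 ⟨x, hyx⟩)) hyx rfl
      exact ⟨z, y, hy, rfl, congrArg Prod.snd this⟩
    · rintro ⟨z, y, hy, rfl, rfl⟩
      exact ⟨y, hy, hk y (h (mem_dom.2 ⟨z, hρ hy⟩))⟩
  have hinj : Set.InjOn (fun p : Fin n × Fin n => (p.1, k p.2)) r := fun p hp q hq hpq =>
    hr.injOn_fst hp hq (Prod.mk.inj hpq).1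
  rw [himage r subset_rfl, mob_image hinj, mob_mul_single]
  refine Finset.sum_congr rfl fun ρ hρ => ?_
  rw [himage ρ (Finset.mem_powerset.1 hρ), mul_one]

theorem IsPartialBij.eq_of_ran_subset {n : ℕ} {s σ : BRel n} (hs : IsPartialBij s) (hσ : σ ⊆ s)
    (h : ran s ⊆ ran σ) : σ = s := by
  refine hσ.antisymm fun p hp => ?_
  obtain ⟨x, hx⟩ := mem_ran.1 (h (mem_ran.2 ⟨p.2, hp⟩))
  rwa [hs.injOn_fst hp (hσ hx) rfl]

/-- Multiplication rule for the Möbius basis of `ℤ[IS_n]` inside `ℤ[B_n]`: for partial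
bijections `r` and `s`, `m_r * m_s = m_{r ∘ s}` if the domain of `r` equals the range
of `s`, and `m_r * m_s = 0` otherwise. -/
theorem mob_mul_mob {n : ℕ} (r s : BRel n)
    (hr : IsPartialBij r) (hs : IsPartialBij s) :
    mob r * mob s = if dom r = ran s then mob (relComp r s) else 0 := by
  by_cases hsub : ran s ⊆ dom r
  · have hsum : mob r * mob s = mob r * MonoidAlgebra.single s 1 := by
      conv_lhs => rw [mob.eq_1 s, Finset.mul_sum]
      rw [Finset.sum_eq_single_of_mem s (Finset.mem_powerset_self s), Nat.sub_self, pow_zero]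
      intro σ hσ hne
      exact mob_mul_single_eq_zero
        (fun h => hne (hs.eq_of_ran_subset (Finset.mem_powerset.1 hσ) (hsub.trans h))) _
    rw [hsum]
    split_ifs with h
    · exact mob_mul_single_one hr hs h.subset
    · exact mob_mul_single_eq_zero (fun h' => h (h'.antisymm hsub)) 1
  · rw [if_neg fun h => hsub h.ge, mob, Finset.sum_mul]
    refine Finset.sum_eq_zero fun ρ hρ => single_mul_mob_eq_zero (fun h => hsub (h.trans ?_)) _
    exact Finset.image_subset_image (Finset.mem_powerset.1 hρ)
end
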